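/- arXiv:1710.07070 — 2 statements merged into one kernel-verified Lean document; each statement's English description precedes it below -/
import Mathlib

section
/- The Borel σ-algebra 𝔐^ψ on 𝔐₁^ψ(E) generated by the ψ-weak topology coincides with the σ-algebra generated by the evaluation maps π_B : μ ↦ μ(B), defined for μ ∈ 𝔐₁^ψ(E), as B varies over the Borel sets of E. -/
open MeasureTheory Filter Topology
open scoped ENNReal NNReal

/-- The one-sided Prohorov distance
`π(μ,ν) = inf {ε > 0 : μ(B) ≤ ν(Bᵉ) + ε for every Borel set B}`. -/
noncomputable def prohorovDist {E : Type*} [PseudoMetricSpace E] [MeasurableSpace E]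
    (μ ν : MeasureTheory.Measure E) : ℝ :=
  sInf {ε : ℝ | 0 < ε ∧ ∀ B : Set E, MeasurableSet B →
    μ B ≤ ν (Metric.thickening ε B) + ENNReal.ofReal ε}

/-- The distance `d_ψ(μ,ν) = π(μ,ν) + |∫ψ dμ − ∫ψ dν|`. -/
noncomputable def dPsi {E : Type*} [PseudoMetricSpace E] [MeasurableSpace E] (ψ : E → ℝ)
    (μ ν : MeasureTheory.Measure E) : ℝ :=
  prohorovDist μ ν + |(∫ x, ψ x ∂μ) - ∫ x, ψ x ∂ν|

/-- The space `𝔐₁^ψ(E)` of Borel probability measures integrating the gauge `ψ`. -/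
abbrev MPsi (E : Type*) [MeasurableSpace E] (ψ : E → ℝ) : Type _ :=
  {μ : MeasureTheory.ProbabilityMeasure E // MeasureTheory.Integrable ψ (μ : MeasureTheory.Measure E)}

/-- The `ψ`-weak topology on `𝔐₁^ψ(E)`: the coarsest topology making `μ ↦ ∫ f dμ`
continuous for every continuous `f : E → ℝ` with `|f| ≤ C·ψ` for some constant `C`. -/
noncomputable def psiWeakTopology (E : Type*) [MeasurableSpace E] [TopologicalSpace E]
    (ψ : E → ℝ) : TopologicalSpace (MPsi E ψ) :=
  ⨅ f : {f : E → ℝ // Continuous f ∧ ∃ C : ℝ, ∀ x, |f x| ≤ C * ψ x},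
    TopologicalSpace.induced (fun μ => ∫ x, f.1 x ∂(μ.1 : MeasureTheory.Measure E)) inferInstance

/-- The finite supremum of the step functions `q • 1_U` over the pairs `(q, U)` in `F`. -/
noncomputable def stepSup {E : Type*} [TopologicalSpace E] [SecondCountableTopology E]
    (F : Finset (ℚ × TopologicalSpace.countableBasis E)) (x : E) : ℝ≥0∞ :=
  F.sup fun p => (p.2 : Set E).indicator (fun _ => ((p.1 : ℝ).toNNReal : ℝ≥0∞)) x

theorem integrable_of_abs_le_mul {E : Type*} [TopologicalSpace E]
    [MeasurableSpace E] [OpensMeasurableSpace E] {ψ f : E → ℝ} (hf : Continuous f) {C : ℝ}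
    (hC : ∀ x, |f x| ≤ C * ψ x) {μ : Measure E} (hψ : Integrable ψ μ) : Integrable f μ :=
  (hψ.const_mul C).mono' hf.measurable.aestronglyMeasurable (.of_forall hC)

section StepSup

variable {E : Type*} [TopologicalSpace E] [SecondCountableTopology E]

theorem measurable_stepSup [MeasurableSpace E] [OpensMeasurableSpace E]
    (F : Finset (ℚ × TopologicalSpace.countableBasis E)) : Measurable (stepSup F) := by
  classical
  induction F using Finset.induction_on with
  | empty => exact measurable_const
  | insert p F _ ih =>
    have heq : stepSup (insert p F) = fun x =>
        (p.2 : Set E).indicator (fun _ => ((p.1 : ℝ).toNNReal : ℝ≥0∞)) x ⊔ stepSup F x :=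
      funext fun _ => Finset.sup_insert
    rw [heq]
    exact (measurable_const.indicator
      (TopologicalSpace.isOpen_of_mem_countableBasis p.2.2).measurableSet).sup ih

theorem stepSup_union_le {g : E → ℝ≥0∞} {F G : Finset (ℚ × TopologicalSpace.countableBasis E)}
    [DecidableEq (ℚ × TopologicalSpace.countableBasis E)]
    (hF : stepSup F ≤ g) (hG : stepSup G ≤ g) :
    stepSup (F ∪ G) ≤ g := fun x => by
  simpa only [stepSup, Finset.sup_union] using sup_le (hF x) (hG x)

theorem stepSup_mono {F G : Finset (ℚ × TopologicalSpace.countableBasis E)} (h : F ⊆ G) :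
    stepSup F ≤ stepSup G :=
  fun _ => Finset.sup_mono h

/-- A lower semicontinuous function is the supremum of the step suprema below it. -/
theorem LowerSemicontinuous.iSup_stepSup_eq {g : E → ℝ≥0∞} (hg : LowerSemicontinuous g) (x : E) :
    ⨆ F : {F : Finset (ℚ × TopologicalSpace.countableBasis E) // stepSup F ≤ g},
      stepSup F.1 x = g x := by
  refine le_antisymm (iSup_le fun F => F.2 x) (le_of_forall_lt fun c hc => ?_)
  obtain ⟨q, -, hcq, hqg⟩ := ENNReal.lt_iff_exists_rat_btwn.1 hc
  obtain ⟨U, hU, hxU, hUg⟩ := (TopologicalSpace.isBasis_countableBasis E).exists_subset_of_mem_open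
    (show x ∈ g ⁻¹' Set.Ioi ((q : ℝ).toNNReal : ℝ≥0∞) from hqg) (hg.isOpen_preimage _)
  have hle : stepSup {(q, (⟨U, hU⟩ : TopologicalSpace.countableBasis E))} ≤ g := fun y => by
    simpa only [stepSup, Finset.sup_singleton] using
      Set.indicator_apply_le (fun hy : y ∈ U => (hUg hy).le)
  refine hcq.trans_le (le_iSup_of_le ⟨_, hle⟩ ?_)
  simp [stepSup, hxU]

theorem LowerSemicontinuous.lintegral_eq_iSup_stepSup [MeasurableSpace E] [OpensMeasurableSpace E]
    {g : E → ℝ≥0∞} (hg : LowerSemicontinuous g) (μ : Measure E) :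
    ∫⁻ x, g x ∂μ =
      ⨆ F : {F : Finset (ℚ × TopologicalSpace.countableBasis E) // stepSup F ≤ g},
        ∫⁻ x, stepSup F.1 x ∂μ := by
  classical
  rw [← lintegral_iSup_directed
    (f := fun F : {F : Finset (ℚ × TopologicalSpace.countableBasis E) // stepSup F ≤ g} =>
      stepSup F.1) (fun F => (measurable_stepSup F.1).aemeasurable)]
  · simp_rw [hg.iSup_stepSup_eq]
  · exact fun F G => ⟨⟨F.1 ∪ G.1, stepSup_union_le F.2 G.2⟩,
      stepSup_mono Finset.subset_union_left, stepSup_mono Finset.subset_union_right⟩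

/-- The integrals of `ψ` and of all step suprema. -/
noncomputable def stepIntegrals [MeasurableSpace E] (ψ : E → ℝ) (μ : MPsi E ψ) :
    ℝ × (Finset (ℚ × TopologicalSpace.countableBasis E) → ℝ≥0∞) :=
  (∫ x, ψ x ∂(μ.1 : Measure E), fun F => ∫⁻ x, stepSup F x ∂(μ.1 : Measure E))

variable [MeasurableSpace E] [OpensMeasurableSpace E]

theorem lowerSemicontinuous_integral_of_stepIntegrals {ψ g : E → ℝ}
    [TopologicalSpace (MPsi E ψ)] (hΦ : Continuous (stepIntegrals (E := E) ψ))
    (hg : Continuous g) (hg0 : 0 ≤ g) (hgi : ∀ μ : MPsi E ψ, Integrable g (μ.1 : Measure E)) :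
    LowerSemicontinuous fun μ : MPsi E ψ => ∫ x, g x ∂(μ.1 : Measure E) := by
  have hL : LowerSemicontinuous
      fun μ : MPsi E ψ => ENNReal.ofReal (∫ x, g x ∂(μ.1 : Measure E)) := by
    have heq (μ : MPsi E ψ) := (ofReal_integral_eq_lintegral_ofReal (hgi μ) (.of_forall hg0)).trans
      ((ENNReal.continuous_ofReal.comp hg).lowerSemicontinuous.lintegral_eq_iSup_stepSup _)
    simp_rw [heq]
    exact lowerSemicontinuous_iSup fun F =>
      ((continuous_apply F.1).comp (continuous_snd.comp hΦ)).lowerSemicontinuous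
  intro μ a ha
  rcases lt_or_ge a 0 with h | h
  · exact .of_forall fun ν => h.trans_le (integral_nonneg hg0)
  · filter_upwards [hL μ _ ((ENNReal.ofReal_lt_ofReal_iff_of_nonneg h).2 ha)] with ν hν
    exact (ENNReal.ofReal_lt_ofReal_iff_of_nonneg h).1 hν

theorem lowerSemicontinuous_integral_of_abs_le {ψ f : E → ℝ} (hψc : Continuous ψ)
    [TopologicalSpace (MPsi E ψ)] (hΦ : Continuous (stepIntegrals (E := E) ψ))
    (hf : Continuous f) {C : ℝ} (hC : ∀ x, |f x| ≤ C * ψ x) :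
    LowerSemicontinuous fun μ : MPsi E ψ => ∫ x, f x ∂(μ.1 : Measure E) := by
  have hfi (μ : MPsi E ψ) := integrable_of_abs_le_mul hf hC μ.2
  have hsum := lowerSemicontinuous_integral_of_stepIntegrals (g := fun x => f x + C * ψ x) hΦ
    (by fun_prop) (fun x => by have := neg_le_of_abs_le (hC x); simp only [Pi.zero_apply]; linarith)
    (fun μ => (hfi μ).add (μ.2.const_mul C))
  have hψ : Continuous fun μ : MPsi E ψ => -(C * ∫ x, ψ x ∂(μ.1 : Measure E)) :=
    (continuous_const.mul (continuous_fst.comp hΦ)).neg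
  have heq (μ : MPsi E ψ) : ∫ x, f x ∂(μ.1 : Measure E) =
      ∫ x, f x + C * ψ x ∂(μ.1 : Measure E) + -(C * ∫ x, ψ x ∂(μ.1 : Measure E)) := by
    rw [integral_add (hfi μ) (μ.2.const_mul C), integral_const_mul]
    ring
  simp_rw [heq]
  exact hsum.add hψ.lowerSemicontinuous

theorem continuous_integral_of_abs_le {ψ f : E → ℝ} (hψc : Continuous ψ)
    [TopologicalSpace (MPsi E ψ)] (hΦ : Continuous (stepIntegrals (E := E) ψ))
    (hf : Continuous f) {C : ℝ} (hC : ∀ x, |f x| ≤ C * ψ x) :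
    Continuous fun μ : MPsi E ψ => ∫ x, f x ∂(μ.1 : Measure E) := by
  refine continuous_iff_lower_upperSemicontinuous.2
    ⟨lowerSemicontinuous_integral_of_abs_le hψc hΦ hf hC, fun μ a ha => ?_⟩
  have := lowerSemicontinuous_integral_of_abs_le hψc hΦ hf.neg (C := C) (by simpa using hC) μ (-a)
  simp only [Pi.neg_apply, integral_neg, neg_lt_neg_iff] at this
  exact this ha

theorem induced_stepIntegrals_le_psiWeakTopology {ψ : E → ℝ} (hψc : Continuous ψ) :
    TopologicalSpace.induced (stepIntegrals ψ) inferInstance ≤ psiWeakTopology E ψ := by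
  let : TopologicalSpace (MPsi E ψ) := .induced (stepIntegrals ψ) inferInstance
  refine le_iInf fun f => ?_
  obtain ⟨f, hf, C, hC⟩ := f
  exact continuous_iff_le_induced.1
    (continuous_integral_of_abs_le hψc continuous_induced_dom hf hC)

theorem measurable_stepIntegrals {ψ : E → ℝ} (hψc : Continuous ψ) [MeasurableSpace (MPsi E ψ)]
    (h : Measurable fun μ : MPsi E ψ => (μ.1 : Measure E)) :
    Measurable (stepIntegrals (E := E) ψ) := by
  refine Measurable.prodMk ?_ (measurable_pi_lambda _ fun F =>
    (Measure.measurable_lintegral (measurable_stepSup F)).comp h)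
  have heq (μ : MPsi E ψ) := integral_eq_lintegral_pos_part_sub_lintegral_neg_part μ.2
  simp_rw [heq]
  exact ((Measure.measurable_lintegral hψc.measurable.ennreal_ofReal).comp h).ennreal_toReal.sub
    ((Measure.measurable_lintegral hψc.measurable.neg.ennreal_ofReal).comp h).ennreal_toReal

end StepSup

open scoped BoundedContinuousFunction in
theorem continuous_lintegral_psiWeakTopology {E : Type*} [TopologicalSpace E]
    [MeasurableSpace E] [OpensMeasurableSpace E] {ψ : E → ℝ} (hψ1 : ∀ x, 1 ≤ ψ x) (f : E →ᵇ ℝ≥0) :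
    Continuous[psiWeakTopology E ψ, inferInstance]
      fun μ : MPsi E ψ => ∫⁻ x, f x ∂(μ.1 : Measure E) := by
  let := psiWeakTopology E ψ
  obtain ⟨C, hC⟩ : ∃ C : ℝ, ∀ x, (f x : ℝ) ≤ C := ⟨nndist f 0, fun x => by
    exact_mod_cast BoundedContinuousFunction.NNReal.upper_bound f x⟩
  have hint : Continuous fun μ : MPsi E ψ => ∫ x, (f x : ℝ) ∂(μ.1 : Measure E) := by
    refine continuous_iff_le_induced.2 (iInf_le _ (⟨fun x => (f x : ℝ), by fun_prop, C,
      fun x => ?_⟩ : {f : E → ℝ // Continuous f ∧ ∃ C : ℝ, ∀ x, |f x| ≤ C * ψ x}))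
    rw [NNReal.abs_eq]
    exact (hC x).trans (le_mul_of_one_le_right ((f x).2.trans (hC x)) (hψ1 x))
  have heq (μ : MPsi E ψ) : ∫⁻ x, f x ∂(μ.1 : Measure E) =
      ENNReal.ofReal (∫ x, (f x : ℝ) ∂(μ.1 : Measure E)) := by
    refine Eq.symm ((ofReal_integral_eq_lintegral_ofReal (f.integrable_of_nnreal _)
      (.of_forall fun x => (f x).2)).trans ?_)
    simp
  simp_rw [heq]
  exact ENNReal.continuous_ofReal.comp hint

theorem measurable_coe_borel_psiWeakTopology {E : Type*} [TopologicalSpace E]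
    [HasOuterApproxClosed E] [MeasurableSpace E] [BorelSpace E] {ψ : E → ℝ}
    (hψ1 : ∀ x, 1 ≤ ψ x) :
    Measurable[@borel (MPsi E ψ) (psiWeakTopology E ψ)]
      fun μ : MPsi E ψ => (μ.1 : Measure E) := by
  let := psiWeakTopology E ψ
  let : MeasurableSpace (MPsi E ψ) := borel _
  have : BorelSpace (MPsi E ψ) := ⟨rfl⟩
  refine Measurable.measure_of_isPiSystem_of_isProbabilityMeasure
    (BorelSpace.measurable_eq.trans borel_eq_generateFrom_isClosed) isPiSystem_isClosed
    fun F hF => ?_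
  refine ENNReal.measurable_of_tendsto
    (fun n => (continuous_lintegral_psiWeakTopology hψ1 (IsClosed.apprSeq hF n)).measurable) ?_
  exact tendsto_pi_nhds.2 fun μ => HasOuterApproxClosed.tendsto_lintegral_apprSeq hF _

/-- The Borel σ-algebra on `𝔐₁^ψ(E)` generated by the `ψ`-weak topology coincides with the
σ-algebra generated by the evaluation maps `π_B : μ ↦ μ(B)`, defined for `μ ∈ 𝔐₁^ψ(E)`,
as `B` varies over the Borel sets of `E`. -/
theorem borel_psiWeak_eq_comap_eval (E : Type*) [TopologicalSpace E] [PolishSpace E]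
    [MeasurableSpace E] [BorelSpace E]
    (ψ : E → ℝ) (hψc : Continuous ψ) (hψ1 : ∀ x, 1 ≤ ψ x) :
    @borel (MPsi E ψ) (psiWeakTopology E ψ) =
      ⨆ (B : Set E) (_ : MeasurableSet B),
        MeasurableSpace.comap (fun μ : MPsi E ψ => (μ.1 : Measure E) B) inferInstance := by
  refine le_antisymm ?_ (iSup₂_le fun B hB => ?_)
  · refine (borel_anti (induced_stepIntegrals_le_psiWeakTopology hψc)).trans ?_
    rw [borel_comap.trans (congrArg _ BorelSpace.measurable_eq.symm)]
    let : MeasurableSpace (MPsi E ψ) := ⨆ (B : Set E) (_ : MeasurableSet B),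
      MeasurableSpace.comap (fun μ : MPsi E ψ => (μ.1 : Measure E) B) inferInstance
    refine (measurable_stepIntegrals hψc (Measure.measurable_of_measurable_coe _
      fun B hB => ?_)).comap_le
    exact measurable_iff_comap_le.2 (le_iSup₂_of_le B hB le_rfl)
  · exact ((Measure.measurable_coe hB).comp (measurable_coe_borel_psiWeakTopology hψ1)).comap_le
end

section
/- Let θ : Ω → Ω be ℱ-measurable and let ℙ_θ = ℙ∘θ^{-1}. Assume ∫_E ψ d(ℙ∘ξ₁^{-1}) < ∞, and let τ : 𝔐₁^ψ(E) → T be uniformly ψ-continuous with modulus of continuity κ, i.e. κ : [0,∞) → [0,∞) is continuous, strictly increasing, vanishes at zero, and d_T(τ(μ),τ(ν)) ≤ κ(d_ψ(μ,ν)) for all μ,ν ∈ 𝔐₁^ψ(E). Then π_T(ℙ∘τ(υ)^{-1}, ℙ_θ∘τ(υ)^{-1}) ≤ κ(‖θ‖_{ℙ,κ}), where π_T denotes the Prohorov distance between Borel probability measures on T, and ‖θ‖_{ℙ,κ} = inf{α > 0 : ℙ{d_ψ(υ, υ∘θ) > α} < κ(α)}. -/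
/-- The shift operator `Σ(x₁,x₂,…) = (x₂,x₃,…)` on `E^ℕ`. -/
def shift {E : Type*} (ω : ℕ → E) : ℕ → E := fun n => ω (n + 1)

/-- The shift-invariant σ-algebra `ℐ = {I ∈ ℰ^ℕ : Σ⁻¹(I) = I}` on `E^ℕ` (identified, via the
coordinate process `ξ`, with `ξ⁻¹ℐ`). -/
def shiftInvariantSigma (E : Type*) [MeasurableSpace E] : MeasurableSpace (ℕ → E) where
  MeasurableSet' I := MeasurableSet I ∧ shift ⁻¹' I = I
  measurableSet_empty := ⟨MeasurableSet.empty, by simp⟩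
  measurableSet_compl := fun s hs => ⟨hs.1.compl, by rw [Set.preimage_compl, hs.2]⟩
  measurableSet_iUnion := fun s hs =>
    ⟨MeasurableSet.iUnion fun i => (hs i).1, by simp [Set.preimage_iUnion, fun i => (hs i).2]⟩

open MeasureTheory Filter Topology
open scoped ENNReal NNReal

/-- The quantity `‖θ‖_{ℙ,κ} = inf {α > 0 : ℙ{d_ψ(υ, υ∘θ) > α} < κ(α)}`. -/
noncomputable def thetaNorm {E : Type*} [MetricSpace E] [MeasurableSpace E] (ψ : E → ℝ)
    (ℙ : Measure (ℕ → E)) (υ : (ℕ → E) → MPsi E ψ) (θ : (ℕ → E) → ℕ → E) (κ : ℝ → ℝ) : ℝ :=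
  sInf {α : ℝ | 0 < α ∧
    ℙ {ω | α < dPsi ψ ((υ ω).1 : Measure E) ((υ (θ ω)).1 : Measure E)} < ENNReal.ofReal (κ α)}

/-- The countable family of sets `{μ | q < μ G}`, with `q` rational and `G` a finite union of
members of a countable basis of `E`. -/
def MeasureTheory.ProbabilityMeasure.countableSubbasis (E : Type*) [TopologicalSpace E]
    [SecondCountableTopology E] [MeasurableSpace E] : Set (Set (ProbabilityMeasure E)) :=
  Set.range fun p : Finset (TopologicalSpace.countableBasis E) × ℚ =>
    {μ | ENNReal.ofReal p.2 < (μ : Measure E) (⋃ b ∈ p.1, (b : Set E))}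

/-- The mass of an open set is approximated from inside by finite unions of basic sets. -/
theorem exists_finset_countableBasis_lt_measure {E : Type*} [TopologicalSpace E]
    [SecondCountableTopology E] [MeasurableSpace E] (μ : Measure E) {G : Set E} (hG : IsOpen G)
    {r : ℝ≥0∞} (hr : r < μ G) :
    ∃ F : Finset (TopologicalSpace.countableBasis E),
      (⋃ b ∈ F, (b : Set E)) ⊆ G ∧ r < μ (⋃ b ∈ F, (b : Set E)) := by
  classical
  let ι := {F : Finset (TopologicalSpace.countableBasis E) // (⋃ b ∈ F, (b : Set E)) ⊆ G}
  have hdir : Directed (· ⊆ ·) fun F : ι => ⋃ b ∈ F.1, (b : Set E) := by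
    intro F₁ F₂
    refine ⟨⟨F₁.1 ∪ F₂.1, ?_⟩, ?_, ?_⟩
    · rw [Finset.set_biUnion_union]
      exact Set.union_subset F₁.2 F₂.2
    · exact Set.biUnion_subset_biUnion_left fun _ h => Finset.mem_union_left _ h
    · exact Set.biUnion_subset_biUnion_left fun _ h => Finset.mem_union_right _ h
  have hU : (⋃ F : ι, ⋃ b ∈ F.1, (b : Set E)) = G := by
    refine Set.Subset.antisymm (Set.iUnion_subset fun F => F.2) fun x hx => ?_
    obtain ⟨b, hb, hxb, hbG⟩ :=
      (TopologicalSpace.isBasis_countableBasis E).exists_subset_of_mem_open hx hG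
    exact Set.mem_iUnion.2 ⟨⟨{⟨b, hb⟩}, by simpa using hbG⟩, by simpa using hxb⟩
  rw [← hU, hdir.measure_iUnion, lt_iSup_iff] at hr
  obtain ⟨F, hF⟩ := hr
  exact ⟨F.1, F.2, hF⟩

namespace MeasureTheory.ProbabilityMeasure

variable {E : Type*} [TopologicalSpace E] [TopologicalSpace.PseudoMetrizableSpace E]
  [MeasurableSpace E] [OpensMeasurableSpace E]

theorem isOpen_setOf_lt_measure {G : Set E} (hG : IsOpen G) (r : ℝ≥0∞) :
    IsOpen {μ : ProbabilityMeasure E | r < (μ : Measure E) G} := by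
  rw [isOpen_iff_mem_nhds]
  intro μ hμ
  exact eventually_lt_of_lt_liminf (lt_of_lt_of_le hμ
    (ProbabilityMeasure.le_liminf_measure_open_of_tendsto tendsto_id hG))

variable [SecondCountableTopology E]

/-- The weak topology on probability measures over a separable metrizable space is generated by
`countableSubbasis`. -/
theorem eq_generateFrom_countableSubbasis :
    (inferInstance : TopologicalSpace (ProbabilityMeasure E)) =
      TopologicalSpace.generateFrom (countableSubbasis E) := by
  refine le_antisymm (le_generateFrom ?_) ?_
  · rintro _ ⟨p, rfl⟩
    exact isOpen_setOf_lt_measure (isOpen_biUnion fun b _ =>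
      TopologicalSpace.isOpen_of_mem_countableBasis b.2) _
  · refine le_of_nhds_le_nhds fun μ => ?_
    set L := @nhds _ (TopologicalSpace.generateFrom (countableSubbasis E)) μ
    have : L.IsCountablyGenerated := by
      let := TopologicalSpace.generateFrom (countableSubbasis E)
      have : SecondCountableTopology (ProbabilityMeasure E) :=
        ⟨countableSubbasis E, Set.countable_range _, rfl⟩
      exact inferInstanceAs (𝓝 μ).IsCountablyGenerated
    refine tendsto_of_forall_isOpen_le_liminf' (μs := id) (L := L) fun G hG => ?_
    refine le_of_forall_lt fun r hr => ?_
    obtain ⟨q, hq0, hrq, hqG⟩ := ENNReal.lt_iff_exists_rat_btwn.1 hr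
    obtain ⟨F, hFG, hF⟩ := exists_finset_countableBasis_lt_measure (μ : Measure E) hG hqG
    refine lt_of_lt_of_le hrq (le_liminf_of_le (by isBoundedDefault) ?_)
    have hmem : {ν : ProbabilityMeasure E |
        ENNReal.ofReal q < (ν : Measure E) (⋃ b ∈ F, (b : Set E))} ∈ L := by
      let := TopologicalSpace.generateFrom (countableSubbasis E)
      exact IsOpen.mem_nhds (TopologicalSpace.isOpen_generateFrom_of_mem ⟨(F, q), rfl⟩) hF
    filter_upwards [hmem] with ν hν
    exact hν.le.trans (measure_mono hFG)

theorem secondCountableTopology : SecondCountableTopology (ProbabilityMeasure E) :=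
  ⟨countableSubbasis E, Set.countable_range _, eq_generateFrom_countableSubbasis⟩

theorem opensMeasurableSpace : OpensMeasurableSpace (ProbabilityMeasure E) := by
  have : SecondCountableTopology (ProbabilityMeasure E) := secondCountableTopology
  constructor
  rw [borel_eq_generateFrom_of_subbasis (eq_generateFrom_countableSubbasis (E := E))]
  refine MeasurableSpace.generateFrom_le ?_
  rintro _ ⟨p, rfl⟩
  have hG : MeasurableSet (⋃ b ∈ p.1, (b : Set E)) := (isOpen_biUnion fun b _ =>
    TopologicalSpace.isOpen_of_mem_countableBasis b.2).measurableSet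
  exact measurableSet_lt measurable_const
    ((Measure.measurable_coe hG).comp measurable_subtype_coe)

end MeasureTheory.ProbabilityMeasure

section Prohorov

variable {E : Type*} [PseudoMetricSpace E] [MeasurableSpace E]

theorem prohorovDist_nonneg (μ ν : Measure E) : 0 ≤ prohorovDist μ ν :=
  Real.sInf_nonneg fun _ h => h.1.le

theorem prohorovDist_le_of_forall {μ ν : Measure E} {ε : ℝ} (hε : 0 < ε)
    (h : ∀ B : Set E, MeasurableSet B →
      μ B ≤ ν (Metric.thickening ε B) + ENNReal.ofReal ε) : prohorovDist μ ν ≤ ε :=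
  csInf_le ⟨0, fun _ h => h.1.le⟩ ⟨hε, h⟩

theorem prohorovDist_le_one (μ ν : Measure E) [IsProbabilityMeasure μ] : prohorovDist μ ν ≤ 1 :=
  prohorovDist_le_of_forall one_pos fun _ _ => by
    simpa using prob_le_one.trans le_add_self

theorem prohorovDist_le_levyProkhorovDist (μ ν : Measure E) [IsFiniteMeasure μ]
    [IsFiniteMeasure ν] : prohorovDist μ ν ≤ levyProkhorovDist μ ν := by
  refine le_of_forall_gt_imp_ge_of_dense fun ε hε => ?_
  have hε0 : 0 < ε := ENNReal.toReal_nonneg.trans_lt hε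
  refine prohorovDist_le_of_forall hε0 fun B hB => ?_
  have hlt : levyProkhorovEDist μ ν < ENNReal.ofReal ε :=
    (ENNReal.lt_ofReal_iff_toReal_lt (levyProkhorovEDist_ne_top μ ν)).2 hε
  simpa [ENNReal.toReal_ofReal hε0.le] using left_measure_le_of_levyProkhorovEDist_lt hlt hB

theorem dPsi_nonneg (ψ : E → ℝ) (μ ν : Measure E) : 0 ≤ dPsi ψ μ ν :=
  add_nonneg (prohorovDist_nonneg μ ν) (abs_nonneg _)

/-- If `X` and `Y` are at distance at most `r` outside an event of probability at most `r`, then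
the Prohorov distance between their laws is at most `r`. -/
theorem prohorovDist_map_le {Ω : Type*} [MeasurableSpace Ω] [OpensMeasurableSpace E]
    {P : Measure Ω} {X Y : Ω → E} (hX : Measurable X) (hY : Measurable Y) {r : ℝ} (hr : 0 ≤ r)
    (h : P {ω | r < dist (X ω) (Y ω)} ≤ ENNReal.ofReal r) :
    prohorovDist (P.map X) (P.map Y) ≤ r := by
  refine le_of_forall_gt_imp_ge_of_dense fun ε hε => ?_
  refine prohorovDist_le_of_forall (hr.trans_lt hε) fun B hB => ?_
  rw [Measure.map_apply hX hB, Measure.map_apply hY Metric.isOpen_thickening.measurableSet]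
  calc P (X ⁻¹' B)
      ≤ P (Y ⁻¹' Metric.thickening ε B ∪ {ω | r < dist (X ω) (Y ω)}) := by
        refine measure_mono fun ω hω => ?_
        by_cases hd : r < dist (X ω) (Y ω)
        · exact Or.inr hd
        · refine Or.inl (Metric.mem_thickening_iff.2 ⟨X ω, hω, ?_⟩)
          rw [dist_comm]
          exact (not_lt.1 hd).trans_lt hε
    _ ≤ P (Y ⁻¹' Metric.thickening ε B) + P {ω | r < dist (X ω) (Y ω)} := measure_union_le _ _
    _ ≤ P (Y ⁻¹' Metric.thickening ε B) + ENNReal.ofReal ε := by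
        gcongr
        exact h.trans (ENNReal.ofReal_le_ofReal hε.le)

end Prohorov

/-- The tails of a measurable real function have vanishing mass. -/
theorem exists_measure_setOf_lt_lt {Ω : Type*} [MeasurableSpace Ω] (P : Measure Ω)
    [IsFiniteMeasure P] {f : Ω → ℝ} (hf : Measurable f) {δ : ℝ≥0∞} (hδ : 0 < δ) :
    ∃ n : ℕ, P {ω | (n : ℝ) < f ω} < δ := by
  have hlim : Tendsto (fun n : ℕ => P {ω | (n : ℝ) < f ω}) atTop (𝓝 0) := by
    have hemp : (⋂ n : ℕ, {ω | (n : ℝ) < f ω}) = ∅ := by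
      refine Set.eq_empty_iff_forall_notMem.2 fun ω hω => ?_
      obtain ⟨n, hn⟩ := exists_nat_ge (f ω)
      exact absurd (Set.mem_iInter.1 hω n) (not_lt.2 hn)
    have := tendsto_measure_iInter_atTop (μ := P) (s := fun n : ℕ => {ω | (n : ℝ) < f ω})
      (fun n => (measurableSet_lt measurable_const hf).nullMeasurableSet)
      (fun m n hmn ω (hω : (n : ℝ) < f ω) => (Nat.cast_le.2 hmn).trans_lt hω) ⟨0, measure_ne_top _ _⟩
    simpa [hemp, Function.comp_def] using this
  exact (hlim.eventually_lt_const hδ).exists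

/-- A map on `MPsi E ψ` with a modulus of continuity for `dPsi` is measurable along any
measurable random measure. -/
theorem measurable_comp_of_modulus {E T Ω : Type*} [MetricSpace E] [SecondCountableTopology E]
    [MeasurableSpace E] [BorelSpace E] [PseudoMetricSpace T] [MeasurableSpace T] [BorelSpace T]
    [MeasurableSpace Ω] {ψ : E → ℝ} {υ : Ω → MPsi E ψ}
    (hυ : Measurable fun ω => (υ ω).1)
    (hυψ : Measurable fun ω => ∫ x, ψ x ∂((υ ω).1 : Measure E))
    {τ : MPsi E ψ → T} {κ : ℝ → ℝ} (hκ : ContinuousAt κ 0) (hκ0 : κ 0 = 0)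
    (hmod : ∀ μ ν : MPsi E ψ,
      dist (τ μ) (τ ν) ≤ κ (dPsi ψ (μ.1 : Measure E) (ν.1 : Measure E))) :
    Measurable fun ω => τ (υ ω) := by
  have : SecondCountableTopology (ProbabilityMeasure E) :=
    ProbabilityMeasure.secondCountableTopology
  have : OpensMeasurableSpace (ProbabilityMeasure E) := ProbabilityMeasure.opensMeasurableSpace
  let Φ : MPsi E ψ → ProbabilityMeasure E × ℝ := fun μ => (μ.1, ∫ x, ψ x ∂(μ.1 : Measure E))
  have hΦ : Measurable fun ω => Φ (υ ω) := hυ.prodMk hυψ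
  have hτ : ∀ U : Set T, IsOpen U → ∃ V, IsOpen V ∧ Φ ⁻¹' V = τ ⁻¹' U := by
    intro U hU
    let : TopologicalSpace (MPsi E ψ) := TopologicalSpace.induced Φ inferInstance
    have hΦc : Continuous Φ := continuous_induced_dom
    suffices hc : Continuous τ from isOpen_induced_iff.1 (hU.preimage hc)
    refine continuous_iff_continuousAt.2 fun μ => ?_
    have hd : Tendsto (fun ν : MPsi E ψ => dPsi ψ (ν.1 : Measure E) (μ.1 : Measure E))
        (𝓝 μ) (𝓝 0) := by
      have h1 : Tendsto (fun ν : MPsi E ψ => dist (LevyProkhorov.ofMeasure ν.1)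
          (LevyProkhorov.ofMeasure μ.1)) (𝓝 μ) (𝓝 0) :=
        tendsto_iff_dist_tendsto_zero.1
          ((LevyProkhorov.continuous_ofMeasure_probabilityMeasure.comp
            (continuous_fst.comp hΦc)).tendsto μ)
      have h2 : Tendsto (fun ν : MPsi E ψ => |(∫ x, ψ x ∂(ν.1 : Measure E)) -
          ∫ x, ψ x ∂(μ.1 : Measure E)|) (𝓝 μ) (𝓝 0) :=
        tendsto_iff_dist_tendsto_zero.1 ((continuous_snd.comp hΦc).tendsto μ)
      refine squeeze_zero (fun ν => dPsi_nonneg _ _ _) (fun ν => ?_) (by simpa using h1.add h2)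
      exact add_le_add (prohorovDist_le_levyProkhorovDist _ _) le_rfl
    refine tendsto_iff_dist_tendsto_zero.2 (squeeze_zero (fun _ => dist_nonneg)
      (fun ν => hmod ν μ) ?_)
    simpa [hκ0, Function.comp_def] using hκ.tendsto.comp hd
  refine measurable_of_isOpen fun U hU => ?_
  obtain ⟨V, hV, hVU⟩ := hτ U hU
  have : (fun ω => τ (υ ω)) ⁻¹' U = (fun ω => Φ (υ ω)) ⁻¹' V := by
    ext ω
    exact (Set.ext_iff.1 hVU (υ ω)).symm
  rw [this]
  exact hΦ hV.measurableSet

/-- Let `θ : Ω → Ω` be measurable and `ℙ_θ = ℙ∘θ⁻¹`. If the law of `ξ₁` integrates `ψ` and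
`τ : 𝔐₁^ψ(E) → T` is uniformly `ψ`-continuous with modulus of continuity `κ` (continuous,
strictly increasing on `[0,∞)`, vanishing at zero, and
`d_T(τ(μ),τ(ν)) ≤ κ(d_ψ(μ,ν))` for all `μ, ν`), then
`π_T(ℙ∘τ(υ)⁻¹, ℙ_θ∘τ(υ)⁻¹) ≤ κ(‖θ‖_{ℙ,κ})`, where `υ` is the canonical random measure
(a regular version of `ℙ[ξ₁ ∈ · | ξ⁻¹ℐ]`, valued in `𝔐₁^ψ(E)`). -/
theorem prohorov_image_le_of_modulus (E : Type*) [MetricSpace E] [PolishSpace E]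
    [MeasurableSpace E] [BorelSpace E]
    (T : Type*) [MetricSpace T] [PolishSpace T] [MeasurableSpace T] [BorelSpace T]
    (ψ : E → ℝ) (hψc : Continuous ψ) (hψ1 : ∀ x, 1 ≤ ψ x)
    (ℙ : Measure (ℕ → E)) [IsProbabilityMeasure ℙ]
    (hint : Integrable ψ (ℙ.map fun ω => ω 0))
    (υ : (ℕ → E) → MPsi E ψ)
    (hυmeas : ∀ B : Set E, MeasurableSet B →
      Measurable[shiftInvariantSigma E] fun ω => ((υ ω).1 : Measure E) B)
    (hυcond : ∀ B : Set E, MeasurableSet B → ∀ A : Set (ℕ → E),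
      MeasurableSet[shiftInvariantSigma E] A →
      ∫⁻ ω in A, ((υ ω).1 : Measure E) B ∂ℙ = ℙ (A ∩ {ω | ω 0 ∈ B}))
    (θ : (ℕ → E) → ℕ → E) (hθ : Measurable θ)
    (τ : MPsi E ψ → T)
    (κ : ℝ → ℝ) (hκc : Continuous κ) (hκmono : StrictMonoOn κ (Set.Ici 0)) (hκ0 : κ 0 = 0)
    (hmod : ∀ μ ν : MPsi E ψ,
      dist (τ μ) (τ ν) ≤ κ (dPsi ψ (μ.1 : Measure E) (ν.1 : Measure E))) :
    prohorovDist (ℙ.map fun ω => τ (υ ω)) ((ℙ.map θ).map fun ω => τ (υ ω)) ≤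
      κ (thetaNorm ψ ℙ υ θ κ) := by
  have hle : shiftInvariantSigma E ≤ MeasurableSpace.pi := fun _ hs => hs.1
  have hυM : Measurable fun ω => ((υ ω).1 : Measure E) :=
    Measure.measurable_of_measurable_coe _ fun B hB => (hυmeas B hB).mono hle le_rfl
  have hυ : Measurable fun ω => (υ ω).1 := hυM.subtype_mk
  have hυψ : Measurable fun ω => ∫ x, ψ x ∂((υ ω).1 : Measure E) := by
    simp_rw [fun ω => integral_eq_lintegral_of_nonneg_ae (μ := ((υ ω).1 : Measure E))
      (Eventually.of_forall fun x => zero_le_one.trans (hψ1 x)) hψc.aestronglyMeasurable]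
    exact ((Measure.measurable_lintegral hψc.measurable.ennreal_ofReal).comp hυM).ennreal_toReal
  have hτυ : Measurable fun ω => τ (υ ω) :=
    measurable_comp_of_modulus hυ hυψ hκc.continuousAt hκ0 hmod
  rw [Measure.map_map hτυ hθ]
  have hκnn : ∀ {a : ℝ}, 0 ≤ a → 0 ≤ κ a := fun ha =>
    hκ0 ▸ hκmono.monotoneOn Set.self_mem_Ici ha ha
  set S := {α : ℝ | 0 < α ∧
    ℙ {ω | α < dPsi ψ ((υ ω).1 : Measure E) ((υ (θ ω)).1 : Measure E)} < ENNReal.ofReal (κ α)}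
  have hSbdd : BddBelow S := ⟨0, fun _ h => h.1.le⟩
  have hSne : S.Nonempty := by
    have hκ1 : 0 < κ 1 := hκ0 ▸ hκmono Set.self_mem_Ici (Set.mem_Ici.2 zero_le_one) one_pos
    obtain ⟨n, hn⟩ := exists_measure_setOf_lt_lt ℙ
      (hυψ.sub (hυψ.comp hθ)).abs (ENNReal.ofReal_pos.2 hκ1)
    refine ⟨1 + n, by positivity, lt_of_le_of_lt (measure_mono fun ω hω => ?_)
      (hn.trans_le (ENNReal.ofReal_le_ofReal (hκmono.monotoneOn (Set.mem_Ici.2 zero_le_one)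
        (Set.mem_Ici.2 (by positivity)) (by simp))))⟩
    have h1 := prohorovDist_le_one ((υ ω).1 : Measure E) ((υ (θ ω)).1 : Measure E)
    have h2 : (1 : ℝ) + n < dPsi ψ ((υ ω).1 : Measure E) ((υ (θ ω)).1 : Measure E) := hω
    unfold dPsi at h2
    change (n : ℝ) < |(∫ x, ψ x ∂((υ ω).1 : Measure E)) - ∫ x, ψ x ∂((υ (θ ω)).1 : Measure E)|
    linarith
  have hbound : ∀ α ∈ S, prohorovDist (ℙ.map fun ω => τ (υ ω))
      (ℙ.map ((fun ω => τ (υ ω)) ∘ θ)) ≤ κ α := by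
    rintro α ⟨hα, hlt⟩
    refine prohorovDist_map_le hτυ (hτυ.comp hθ) (hκnn hα.le)
      ((measure_mono fun ω hω => ?_).trans hlt.le)
    by_contra hcon
    exact absurd ((hmod _ _).trans (hκmono.monotoneOn (dPsi_nonneg _ _ _) hα.le (not_lt.1 hcon)))
      (not_le.2 hω)
  exact closure_minimal hbound (isClosed_le continuous_const hκc) (csInf_mem_closure hSne hSbdd)
end
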